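/- arXiv:1409.3225 — 7 statements merged into one kernel-verified Lean document; each statement's English description precedes it below -/
import Mathlib

section
/- Every directed cycle in the first-preference digraph contains at least one bidirectional link. Precisely: if i_1, i_2, …, i_q are nodes such that there is an arc i_p → i_{p+1} for every 1 ≤ p ≤ q−1 and an arc i_q → i_1, then there exists an index p (indices taken cyclically, so i_{q+1} = i_1) such that both arcs i_p → i_{p+1} and i_{p+1} → i_p exist. -/
/-- Two finite sets satisfy the Give-and-Take (GT) criterion iff each has a
segment unavailable with the other. -/
def GTcrit {N : Type*} [DecidableEq N] (X Y : Finset N) : Prop :=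
  (X \ Y).Nonempty ∧ (Y \ X).Nonempty

/-- `j ∈ l(i)`: node `j` is distinct from `i` and their segment sets satisfy GT. -/
def nbr {M N : Type*} [DecidableEq N] (O : M → Finset N) (i j : M) : Prop :=
  j ≠ i ∧ GTcrit (O i) (O j)

/-- The gain of node `i` from pairing with node `j`:
`g(i,j) = f(|O i ∪ O j|) − f(|O i|)`. -/
noncomputable def gain {M N : Type*} [DecidableEq N] (O : M → Finset N)
    (f : ℕ → ℝ) (i j : M) : ℝ :=
  f ((O i ∪ O j).card) - f ((O i).card)

/-- Arc `i → j` of the first-preference digraph: `j ∈ l(i)` and `j` maximizes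
the gain of `i` over all nodes in `l(i)`. -/
def arc {M N : Type*} [DecidableEq N] (O : M → Finset N) (f : ℕ → ℝ) (i j : M) : Prop :=
  nbr O i j ∧ ∀ j', nbr O i j' → gain O f i j' ≤ gain O f i j

theorem nbr.symm {M N : Type*} [DecidableEq N] {O : M → Finset N} {i j : M}
    (h : nbr O i j) : nbr O j i :=
  ⟨h.1.symm, h.2.2, h.2.1⟩

/-- Every directed cycle in the first-preference digraph contains at least one
bidirectional link. -/
theorem cycle_has_bidirectional_link {M N : Type*} [Fintype M] [DecidableEq N]
    (O : M → Finset N) (f : ℕ → ℝ) (hf : StrictMono f)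
    (q : ℕ) [NeZero q] (ii : Fin q → M)
    (hcyc : ∀ p : Fin q, arc O f (ii p) (ii (p + 1))) :
    ∃ p : Fin q, arc O f (ii p) (ii (p + 1)) ∧ arc O f (ii (p + 1)) (ii p) := by
  obtain ⟨p, hp⟩ := Finite.exists_max fun p => (O (ii p) ∪ O (ii (p + 1))).card
  refine ⟨p, hcyc p, (hcyc p).1.symm, fun j' hj' => ?_⟩
  have hbest := (hcyc (p + 1)).2 j' hj'
  have hmax := hf.monotone (hp (p + 1))
  unfold gain at hbest ⊢
  rw [Finset.union_comm (O (ii (p + 1))) (O (ii p))]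
  linarith
end

section
/- If there exists at least one pair of distinct nodes whose segment sets satisfy the GT criterion, then there exists a stable pair, i.e., distinct nodes i and j with j ∈ l(i), i ∈ l(j), g(i,j) ≥ g(i,j') for every j' ∈ l(i), and g(j,i) ≥ g(j,i') for every i' ∈ l(j). In particular, a partial stable matching (a matching containing at least one stable pair) exists. -/
theorem GTcrit.symm {N : Type*} [DecidableEq N] {X Y : Finset N} (h : GTcrit X Y) :
    GTcrit Y X :=
  And.symm h

/-- If some pair of distinct nodes satisfies the GT criterion, then a stable pair
exists: distinct nodes `i, j`, each in the other's list, each maximizing the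
other's gain; in particular a partial stable matching exists. -/
theorem stable_pair_exists {M N : Type*} [Fintype M] [DecidableEq N]
    (O : M → Finset N) (f : ℕ → ℝ) (hf : StrictMono f)
    (hex : ∃ i j : M, i ≠ j ∧ GTcrit (O i) (O j)) :
    ∃ i j : M, i ≠ j ∧ nbr O i j ∧ nbr O j i ∧
      (∀ j', nbr O i j' → gain O f i j' ≤ gain O f i j) ∧
      (∀ i', nbr O j i' → gain O f j i' ≤ gain O f j i) := by
  obtain ⟨a, b, hab, hGT⟩ := hex
  obtain ⟨⟨i, j⟩, hij, hmax⟩ :=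
    (Set.toFinite {p : M × M | nbr O p.1 p.2}).exists_maximalFor
      (fun p => (O p.1 ∪ O p.2).card) _ ⟨(a, b), hab.symm, hGT⟩
  have hji : nbr O j i := ⟨hij.1.symm, hij.2.symm⟩
  have hle : ∀ k l, nbr O k l → (O k ∪ O l).card ≤ (O i ∪ O j).card := fun k l hkl =>
    (le_total _ _).elim id fun h => hmax (j := (k, l)) hkl h
  refine ⟨i, j, hij.1.symm, hij, hji, fun k hk => ?_, fun k hk => ?_⟩
  · exact sub_le_sub_right (hf.monotone (hle i k hk)) _
  · refine sub_le_sub_right (hf.monotone ?_) _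
    rw [Finset.union_comm (O j) (O i)]
    exact hle j k hk
end

section
/- A maximal partial stable matching obtained by greedy pairing exists. Precisely: there exists a finite sequence of pairwise disjoint unordered pairs {i_1,j_1}, …, {i_t,j_t} of distinct nodes such that for each s, letting R_s be the set of nodes not belonging to any earlier pair {i_1,j_1},…,{i_{s−1},j_{s−1}}, the nodes i_s, j_s ∈ R_s satisfy GT with each other, g(i_s, j_s) ≥ g(i_s, j') for every j' ∈ R_s in l(i_s), and g(j_s, i_s) ≥ g(j_s, i') for every i' ∈ R_s in l(j_s); and moreover no two distinct nodes outside all pairs {i_1,j_1},…,{i_t,j_t} satisfy GT with each other. -/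
/-- Inside any finite set `R`, repeatedly removing a related pair of largest weight yields a
sequence of disjoint pairs after which no related pair is left. -/
theorem exists_greedy_pairing {M W : Type*} [DecidableEq M] [LinearOrder W]
    (r : M → M → Prop) (w : M → M → W) (R : Finset M) :
    ∃ (t : ℕ) (a b : Fin t → M),
      (∀ s, a s ∈ R ∧ b s ∈ R ∧ r (a s) (b s)) ∧
      (∀ s s', s' < s → (a s ≠ a s' ∧ a s ≠ b s') ∧ (b s ≠ a s' ∧ b s ≠ b s')) ∧
      (∀ s, ∀ i ∈ R, ∀ j ∈ R, (∀ s' < s, i ≠ a s' ∧ i ≠ b s') →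
        (∀ s' < s, j ≠ a s' ∧ j ≠ b s') → r i j → w i j ≤ w (a s) (b s)) ∧
      (∀ i ∈ R, ∀ j ∈ R, (∀ s, i ≠ a s ∧ i ≠ b s) → (∀ s, j ≠ a s ∧ j ≠ b s) → ¬ r i j) := by
  classical
  induction R using Finset.strongInduction with
  | H R ih =>
    by_cases hne : ((R ×ˢ R).filter fun p => r p.1 p.2).Nonempty
    · obtain ⟨⟨x, y⟩, hxy, hmax⟩ := Finset.exists_max_image _ (fun p => w p.1 p.2) hne
      simp only [Finset.mem_filter, Finset.mem_product, Prod.forall] at hxy hmax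
      obtain ⟨⟨hx, hy⟩, hrxy⟩ := hxy
      have hlt : R \ {x, y} ⊂ R :=
        Finset.sdiff_ssubset (by simp [Finset.insert_subset_iff, hx, hy]) (by simp)
      have hmem : ∀ i, i ∈ R \ {x, y} ↔ i ∈ R ∧ i ≠ x ∧ i ≠ y := by simp
      obtain ⟨t, a, b, hR, hdisj, hgreedy, hleft⟩ := ih _ hlt
      simp only [hmem] at hR hgreedy hleft
      refine ⟨t + 1, Fin.cons x a, Fin.cons y b, ?_, ?_, ?_, ?_⟩
      · simp only [Fin.forall_fin_succ, Fin.cons_zero, Fin.cons_succ]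
        grind
      · simp only [Fin.forall_fin_succ, Fin.cons_zero, Fin.cons_succ, Fin.succ_lt_succ_iff]
        grind
      · simp only [Fin.forall_fin_succ, Fin.cons_zero, Fin.cons_succ, Fin.succ_lt_succ_iff,
          Fin.succ_pos, true_imp_iff]
        grind
      · simp only [Fin.forall_fin_succ, Fin.cons_zero, Fin.cons_succ]
        grind
    · refine ⟨0, Fin.elim0, Fin.elim0, by simp, by simp, by simp, ?_⟩
      intro i hi j hj _ _ hij
      exact hne ⟨(i, j), by simp [hi, hj, hij]⟩

/-- A maximal partial stable matching obtained by greedy pairing exists: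
a finite sequence of pairwise disjoint pairs `{a s, b s}` of distinct nodes such
that each pair is stable among the nodes `R s` remaining before it was formed,
and no two distinct nodes left unpaired at the end satisfy GT with each other. -/
theorem greedy_maximal_partial_stable_matching_exists
    {M N : Type*} [Fintype M] [DecidableEq M] [DecidableEq N]
    (O : M → Finset N) (f : ℕ → ℝ) (hf : StrictMono f) :
    ∃ (t : ℕ) (a b : Fin t → M),
      (∀ s : Fin t, a s ≠ b s) ∧
      (∀ s s' : Fin t, s ≠ s' → ({a s, b s} : Set M) ∩ ({a s', b s'} : Set M) = ∅) ∧
      (∀ s : Fin t,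
        (∀ s' : Fin t, s' < s → a s ≠ a s' ∧ a s ≠ b s') ∧
        (∀ s' : Fin t, s' < s → b s ≠ a s' ∧ b s ≠ b s') ∧
        GTcrit (O (a s)) (O (b s)) ∧
        (∀ j' : M, (∀ s' : Fin t, s' < s → j' ≠ a s' ∧ j' ≠ b s') →
          nbr O (a s) j' → gain O f (a s) j' ≤ gain O f (a s) (b s)) ∧
        (∀ i' : M, (∀ s' : Fin t, s' < s → i' ≠ a s' ∧ i' ≠ b s') →
          nbr O (b s) i' → gain O f (b s) i' ≤ gain O f (b s) (a s))) ∧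
      (∀ i j : M, i ≠ j →
        (∀ s : Fin t, i ≠ a s ∧ i ≠ b s) →
        (∀ s : Fin t, j ≠ a s ∧ j ≠ b s) →
        ¬ GTcrit (O i) (O j)) := by
  obtain ⟨t, a, b, hrel, hdisj, hgreedy, hleft⟩ :=
    exists_greedy_pairing (nbr O) (fun i j => (O i ∪ O j).card) Finset.univ
  simp only [Finset.mem_univ, true_and, true_imp_iff] at hrel hgreedy hleft
  refine ⟨t, a, b, fun s => (hrel s).1.symm, ?_, fun s => ⟨fun s' h => (hdisj s s' h).1,
    fun s' h => (hdisj s s' h).2, (hrel s).2, ?_, ?_⟩, ?_⟩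
  · intro s s' hne
    rw [← Set.disjoint_iff_inter_eq_empty]
    simp only [Set.disjoint_insert_left, Set.disjoint_singleton_left, Set.mem_insert_iff,
      Set.mem_singleton_iff]
    rcases lt_or_gt_of_ne hne with h | h <;> grind
  · intro j hj hnbr
    exact sub_le_sub_right (hf.monotone
      (hgreedy s (a s) j (fun s' h => (hdisj s s' h).1) hj hnbr)) _
  · intro i hi hnbr
    have h := hgreedy s (b s) i (fun s' h => (hdisj s s' h).2) hi hnbr
    rw [Finset.union_comm (O (a s))] at h
    exact sub_le_sub_right (hf.monotone h) _
  · exact fun i j hij hi hj hgt => hleft i j hi hj ⟨hij.symm, hgt⟩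
end

section
/- Suppose M has at least two nodes and in the initial state O₀ every node's segment set is a proper subset of the overall union U = ⋃_{j ∈ M} O₀ j. Then in any terminal state O reachable from O₀ by valid exchange steps, at least two distinct nodes i and j have O i = O j = U. -/
/-- A valid exchange step: some pair of distinct nodes `i, j` satisfying GT
exchange, both ending with `O i ∪ O j`, all other nodes unchanged. -/
def ExchangeStep {M N : Type*} [DecidableEq N] (O O' : M → Finset N) : Prop :=
  ∃ i j : M, i ≠ j ∧ GTcrit (O i) (O j) ∧
    O' i = O i ∪ O j ∧ O' j = O i ∪ O j ∧ ∀ k, k ≠ i → k ≠ j → O' k = O k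

theorem gtCrit_iff {N : Type*} [DecidableEq N] {X Y : Finset N} :
    GTcrit X Y ↔ ¬ X ⊆ Y ∧ ¬ Y ⊆ X := by
  simp [GTcrit, Finset.sdiff_nonempty]

theorem ExchangeStep.biUnion_eq {M N : Type*} [Fintype M] [DecidableEq N]
    {O O' : M → Finset N} (h : ExchangeStep O O') :
    Finset.univ.biUnion O' = Finset.univ.biUnion O := by
  obtain ⟨i, j, -, -, hi, hj, hk⟩ := h
  apply Finset.Subset.antisymm <;> intro x <;>
    simp only [Finset.mem_biUnion, Finset.mem_univ, true_and] <;> rintro ⟨k, hx⟩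
  · by_cases hki : k = i
    · grind
    · by_cases hkj : k = j <;> grind
  · by_cases hki : k = i
    · exact ⟨i, by grind⟩
    · by_cases hkj : k = j
      · exact ⟨j, by grind⟩
      · exact ⟨k, by grind⟩

/-- Exchange steps preserve the property that the owners of the full union never
consist of a single node. -/
theorem ExchangeStep.exists_ne_eq_biUnion {M N : Type*} [Fintype M] [DecidableEq N]
    {O O' : M → Finset N} (h : ExchangeStep O O')
    (hO : ∀ k, O k = Finset.univ.biUnion O → ∃ l, l ≠ k ∧ O l = Finset.univ.biUnion O) :
    ∀ k, O' k = Finset.univ.biUnion O' → ∃ l, l ≠ k ∧ O' l = Finset.univ.biUnion O' := by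
  intro k hk
  rw [h.biUnion_eq] at hk ⊢
  obtain ⟨i, j, hij, hgt, hi, hj, hrest⟩ := h
  rw [gtCrit_iff] at hgt
  have hsub (m : M) : O m ⊆ Finset.univ.biUnion O :=
    Finset.subset_biUnion_of_mem O (Finset.mem_univ m)
  by_cases hki : k = i
  · subst hki
    exact ⟨j, hij.symm, by rw [hj, ← hi, hk]⟩
  by_cases hkj : k = j
  · subst hkj
    exact ⟨i, hij, by rw [hi, ← hj, hk]⟩
  obtain ⟨l, hlk, hl⟩ := hO k (by rw [← hrest k hki hkj, hk])
  refine ⟨l, hlk, ?_⟩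
  rw [hrest l ?_ ?_, hl]
  · rintro rfl
    exact hgt.2 (hl ▸ hsub j)
  · rintro rfl
    exact hgt.1 (hl ▸ hsub i)

theorem exists_eq_biUnion_of_terminal {M N : Type*} [Fintype M] [Nonempty M] [DecidableEq N]
    {O : M → Finset N} (hterm : ∀ i j : M, i ≠ j → ¬ GTcrit (O i) (O j)) :
    ∃ i, O i = Finset.univ.biUnion O := by
  obtain ⟨i, -, hi⟩ := Finset.exists_max_image Finset.univ (fun k => (O k).card)
    Finset.univ_nonempty
  refine ⟨i, (Finset.subset_biUnion_of_mem O (Finset.mem_univ i)).antisymm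
    (Finset.biUnion_subset.2 fun k _ => ?_)⟩
  by_cases hik : i = k
  · rw [hik]
  · by_contra hki
    have hsub : O i ⊆ O k := by
      by_contra hn
      exact hterm i k hik (gtCrit_iff.2 ⟨hn, hki⟩)
    exact hki (Finset.eq_of_subset_of_card_le hsub (hi k (Finset.mem_univ k))).ge

/-- If `M` has at least two nodes and initially every node's segment set is a
proper subset of the overall union `U`, then in any terminal state reachable by
valid exchange steps at least two distinct nodes possess `U`. -/
theorem terminal_two_nodes_have_union
    {M N : Type*} [Fintype M] [DecidableEq N]
    (O₀ O : M → Finset N)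
    (hM : 1 < Fintype.card M)
    (hproper : ∀ i : M, O₀ i ⊂ Finset.univ.biUnion O₀)
    (hreach : Relation.ReflTransGen ExchangeStep O₀ O)
    (hterm : ∀ i j : M, i ≠ j → ¬ GTcrit (O i) (O j)) :
    ∃ i j : M, i ≠ j ∧ O i = Finset.univ.biUnion O₀ ∧ O j = Finset.univ.biUnion O₀ := by
  have : Nonempty M := Fintype.card_pos_iff.1 (by omega)
  have hinv : Finset.univ.biUnion O = Finset.univ.biUnion O₀ ∧
      ∀ k, O k = Finset.univ.biUnion O → ∃ l, l ≠ k ∧ O l = Finset.univ.biUnion O := by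
    clear hterm
    induction hreach with
    | refl => exact ⟨rfl, fun k hk => absurd hk (hproper k).ne⟩
    | tail _ hstep ih =>
      exact ⟨hstep.biUnion_eq.trans ih.1, hstep.exists_ne_eq_biUnion ih.2⟩
  obtain ⟨i, hi⟩ := exists_eq_biUnion_of_terminal hterm
  obtain ⟨j, hji, hj⟩ := hinv.2 i hi
  exact ⟨i, j, hji.symm, hi.trans hinv.1, hj.trans hinv.1⟩
end

section
/- Suppose |M| = m and in the initial state O₀ every node's segment set is a proper subset of the overall union U = ⋃_{j ∈ M} O₀ j, where |U| = n. Then for any terminal state O reachable from O₀ by valid exchange steps, the aggregate cardinality satisfies ∑_{i ∈ M} |O i| ≤ n·m − (m mod 2). -/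
namespace ExchangeStep

variable {M N : Type*} [DecidableEq N] {O O' : M → Finset N}

/-- Exchange steps preserve containment in a fixed set. -/
theorem subset_of_forall_subset (h : ExchangeStep O O') {U : Finset N} (hU : ∀ i, O i ⊆ U)
    (k : M) : O' k ⊆ U := by
  obtain ⟨i, j, -, -, hi, hj, hk⟩ := h
  by_cases hki : k = i
  · rw [hki, hi]
    exact Finset.union_subset (hU i) (hU j)
  by_cases hkj : k = j
  · rw [hkj, hj]
    exact Finset.union_subset (hU i) (hU j)
  rw [hk k hki hkj]
  exact hU k

/-- Exchange steps inside `U` preserve evenness of the number of nodes holding all of `U`: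
neither participant holds `U` before the exchange, and afterwards both or neither do. -/
theorem even_card_filter_eq [Fintype M] (h : ExchangeStep O O') {U : Finset N}
    (hU : ∀ i, O i ⊆ U) (heven : Even (Finset.univ.filter fun i => O i = U).card) :
    Even (Finset.univ.filter fun i => O' i = U).card := by
  classical
  obtain ⟨i, j, hij, ⟨hdi, hdj⟩, hi, hj, hk⟩ := h
  have hiU : O i ≠ U := fun h => by
    simp [h, Finset.sdiff_eq_empty_iff_subset.mpr (hU j)] at hdj
  have hjU : O j ≠ U := fun h => by
    simp [h, Finset.sdiff_eq_empty_iff_subset.mpr (hU i)] at hdi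
  by_cases hu : O i ∪ O j = U
  · have hfilter : (Finset.univ.filter fun k => O' k = U) =
        insert i (insert j (Finset.univ.filter fun k => O k = U)) := by
      ext k
      simp only [Finset.mem_filter, Finset.mem_univ, true_and, Finset.mem_insert]
      by_cases hki : k = i
      · simp [hki, hi, hu]
      by_cases hkj : k = j
      · simp [hkj, hj, hu]
      simp [hki, hkj, hk k hki hkj]
    rw [hfilter, Finset.card_insert_of_notMem (by simp [hij, hiU]),
      Finset.card_insert_of_notMem (by simp [hjU])]
    exact heven.add even_two
  · have hfilter : (Finset.univ.filter fun k => O' k = U) =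
        Finset.univ.filter fun k => O k = U := by
      ext k
      simp only [Finset.mem_filter, Finset.mem_univ, true_and]
      by_cases hki : k = i
      · simp [hki, hi, hu, hiU]
      by_cases hkj : k = j
      · simp [hkj, hj, hu, hjU]
      rw [hk k hki hkj]
    rwa [hfilter]

end ExchangeStep

/-- If initially every node's segment set is a proper subset of the overall
union `U` with `|U| = n` and `|M| = m`, then in any terminal state reachable by
valid exchange steps the aggregate cardinality is at most `n·m − (m mod 2)`. -/
theorem terminal_aggregate_cardinality_upper_bound
    {M N : Type*} [Fintype M] [DecidableEq N]
    (O₀ O : M → Finset N) (m n : ℕ)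
    (hm : Fintype.card M = m)
    (hn : (Finset.univ.biUnion O₀).card = n)
    (hproper : ∀ i : M, O₀ i ⊂ Finset.univ.biUnion O₀)
    (hreach : Relation.ReflTransGen ExchangeStep O₀ O)
    (hterm : ∀ i j : M, i ≠ j → ¬ GTcrit (O i) (O j)) :
    ∑ i : M, (O i).card ≤ n * m - (m % 2) := by
  subst hm hn
  set U := Finset.univ.biUnion O₀
  have hinv : (∀ i, O i ⊆ U) ∧ Even (Finset.univ.filter fun i => O i = U).card := by
    clear hterm
    induction hreach with
    | refl =>
      refine ⟨fun i => (hproper i).subset, ?_⟩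
      simp [Finset.filter_false_of_mem fun i _ => (hproper i).ne]
    | tail _ hstep ih =>
      exact ⟨hstep.subset_of_forall_subset ih.1, hstep.even_card_filter_eq ih.1 ih.2⟩
  obtain ⟨hsub, heven⟩ := hinv
  have hsum : ∑ _i : M, U.card = U.card * Fintype.card M := by simp [mul_comm]
  rw [← hsum]
  rcases Nat.mod_two_eq_zero_or_one (Fintype.card M) with hm | hm
  · rw [hm, Nat.sub_zero]
    exact Finset.sum_le_sum fun i _ => Finset.card_le_card (hsub i)
  · obtain ⟨i, hi⟩ : ∃ i, O i ≠ U := by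
      by_contra! hall
      rw [Finset.filter_true_of_mem fun i _ => hall i, Finset.card_univ, Nat.even_iff] at heven
      omega
    rw [hm]
    exact Nat.le_sub_one_of_lt (Finset.sum_lt_sum
      (fun i _ => Finset.card_le_card (hsub i))
      ⟨i, Finset.mem_univ i, Finset.card_lt_card ((hsub i).ssubset_of_ne hi)⟩)
end

section
/- Suppose in the initial state O₀ no node's segment set equals the overall union U = ⋃_{j ∈ M} O₀ j. Then in every state O reachable from O₀ by valid exchange steps, the number of nodes i with O i = U is even. -/
theorem ExchangeStep.subset {M N : Type*} [DecidableEq N] {O O' : M → Finset N} {U : Finset N}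
    (h : ExchangeStep O O') (hU : ∀ i, O i ⊆ U) (k : M) : O' k ⊆ U := by
  obtain ⟨i, j, -, -, hi, hj, hk⟩ := h
  by_cases hki : k = i
  · rw [hki, hi]
    exact Finset.union_subset (hU i) (hU j)
  by_cases hkj : k = j
  · rw [hkj, hj]
    exact Finset.union_subset (hU i) (hU j)
  · rw [hk k hki hkj]
    exact hU k

/-- An exchange step below `U` preserves evenness of the number of nodes possessing `U`:
neither exchanging node has `U` beforehand, and afterwards both have it or neither does. -/
theorem ExchangeStep.even_card_filter_eq_s5 {M N : Type*} [Fintype M] [DecidableEq N]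
    {O O' : M → Finset N} {U : Finset N} (h : ExchangeStep O O') (hU : ∀ i, O i ⊆ U)
    (he : Even (Finset.univ.filter (fun i : M => O i = U)).card) :
    Even (Finset.univ.filter (fun i : M => O' i = U)).card := by
  classical
  obtain ⟨i, j, hij, ⟨hGij, hGji⟩, hi, hj, hk⟩ := h
  have hiU : O i ≠ U := fun e => by
    rw [e, Finset.sdiff_eq_empty_iff_subset.mpr (hU j)] at hGji
    exact Finset.not_nonempty_empty hGji
  have hjU : O j ≠ U := fun e => by
    rw [e, Finset.sdiff_eq_empty_iff_subset.mpr (hU i)] at hGij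
    exact Finset.not_nonempty_empty hGij
  by_cases hu : O i ∪ O j = U
  · have hs : Finset.univ.filter (fun k : M => O' k = U) =
        insert i (insert j (Finset.univ.filter (fun k : M => O k = U))) := by
      ext k
      simp only [Finset.mem_filter, Finset.mem_univ, true_and, Finset.mem_insert]
      by_cases hki : k = i
      · simp [hki, hi, hu]
      by_cases hkj : k = j
      · simp [hkj, hj, hu]
      · simp [hki, hkj, hk k hki hkj]
    rw [hs, Finset.card_insert_of_notMem (by simp [hij, hiU]),
      Finset.card_insert_of_notMem (by simp [hjU])]
    exact he.add even_two
  · have hs : Finset.univ.filter (fun k : M => O' k = U) =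
        Finset.univ.filter (fun k : M => O k = U) := by
      ext k
      simp only [Finset.mem_filter, Finset.mem_univ, true_and]
      by_cases hki : k = i
      · simp [hki, hi, hu, hiU]
      by_cases hkj : k = j
      · simp [hkj, hj, hu, hjU]
      · simp [hk k hki hkj]
    rwa [hs]

/-- If initially no node's segment set equals the overall union `U`, then in
every state reachable by valid exchange steps the number of nodes possessing
`U` is even. -/
theorem nodes_with_union_even
    {M N : Type*} [Fintype M] [DecidableEq N]
    (O₀ O : M → Finset N)
    (hne : ∀ i : M, O₀ i ≠ Finset.univ.biUnion O₀)
    (hreach : Relation.ReflTransGen ExchangeStep O₀ O) :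
    Even (Finset.univ.filter (fun i : M => O i = Finset.univ.biUnion O₀)).card := by
  suffices h : (∀ i, O i ⊆ Finset.univ.biUnion O₀) ∧
      Even (Finset.univ.filter (fun i : M => O i = Finset.univ.biUnion O₀)).card from h.2
  induction hreach with
  | refl => exact ⟨fun i => Finset.subset_biUnion_of_mem O₀ (Finset.mem_univ i), by simp [hne]⟩
  | tail _ hstep ih => exact ⟨hstep.subset ih.1, hstep.even_card_filter_eq_s5 ih.1 ih.2⟩
end

section
/- Every valid exchange step strictly increases the aggregate cardinality by at least 2, and consequently any sequence of valid exchange steps terminates: if state O is obtained from O₀ by a sequence of t valid exchange steps, then ∑_{i ∈ M} |O i| ≥ ∑_{i ∈ M} |O₀ i| + 2t; hence 2t ≤ |M| · |⋃_{i ∈ M} O₀ i| − ∑_{i ∈ M} |O₀ i|. -/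
theorem GTcrit.card_left_lt_card_union {N : Type*} [DecidableEq N] {X Y : Finset N}
    (h : GTcrit X Y) : X.card < (X ∪ Y).card := by
  obtain ⟨x, hx⟩ := h.2
  rw [Finset.mem_sdiff] at hx
  exact Finset.card_lt_card (Finset.ssubset_iff_subset_ne.2 ⟨Finset.subset_union_left,
    fun he => hx.2 (he ▸ Finset.mem_union_right X hx.1)⟩)

theorem GTcrit.card_right_lt_card_union {N : Type*} [DecidableEq N] {X Y : Finset N}
    (h : GTcrit X Y) : Y.card < (X ∪ Y).card :=
  Finset.union_comm Y X ▸ card_left_lt_card_union (And.symm h)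

/-- A valid exchange step increases the aggregate cardinality by at least `2`. -/
theorem ExchangeStep.sum_card_add_two_le {M N : Type*} [Fintype M] [DecidableEq N]
    {O O' : M → Finset N} (h : ExchangeStep O O') :
    (∑ k : M, (O k).card) + 2 ≤ ∑ k : M, (O' k).card := by
  classical
  obtain ⟨i, j, hij, hgt, hi, hj, hk⟩ := h
  have hle : ∀ k ∈ Finset.univ, (O k).card + ((if k = i then 1 else 0) + if k = j then 1 else 0) ≤
      (O' k).card := by
    intro k _
    by_cases hki : k = i
    · subst hki
      simpa [hij, hi] using hgt.card_left_lt_card_union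
    by_cases hkj : k = j
    · subst hkj
      simpa [hki, hj] using hgt.card_right_lt_card_union
    simp [hki, hkj, hk k hki hkj]
  simpa [Finset.sum_add_distrib] using Finset.sum_le_sum hle

/-- An exchange step creates no new segments. -/
theorem ExchangeStep.subset_of_forall_subset_s7 {M N : Type*} [DecidableEq N]
    {O O' : M → Finset N} (h : ExchangeStep O O') {U : Finset N} (hU : ∀ k, O k ⊆ U) (k : M) :
    O' k ⊆ U := by
  obtain ⟨i, j, -, -, hi, hj, hk⟩ := h
  by_cases hki : k = i
  · subst hki
    exact hi ▸ Finset.union_subset (hU _) (hU _)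
  by_cases hkj : k = j
  · subst hkj
    exact hj ▸ Finset.union_subset (hU _) (hU _)
  exact hk k hki hkj ▸ hU k

/-- Every valid exchange step increases the aggregate cardinality by at least
`2`: after `t` valid exchange steps the aggregate cardinality has gained at
least `2t`, and hence `2t ≤ |M| · |⋃ i, O₀ i| − ∑ i, |O₀ i|`. -/
theorem exchange_steps_increase_aggregate
    {M N : Type*} [Fintype M] [DecidableEq N]
    (t : ℕ) (Os : ℕ → M → Finset N)
    (hstep : ∀ p < t, ExchangeStep (Os p) (Os (p + 1))) :
    (∑ i : M, ((Os 0) i).card) + 2 * t ≤ ∑ i : M, ((Os t) i).card ∧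
    2 * t ≤ Fintype.card M * (Finset.univ.biUnion (Os 0)).card
              - ∑ i : M, ((Os 0) i).card := by
  have hsum : ∀ p ≤ t, (∑ i : M, (Os 0 i).card) + 2 * p ≤ ∑ i : M, (Os p i).card := by
    intro p hp
    induction p with
    | zero => simp
    | succ p ih =>
      have := ih (by omega)
      have := (hstep p hp).sum_card_add_two_le
      omega
  have hsub : ∀ p ≤ t, ∀ k, Os p k ⊆ Finset.univ.biUnion (Os 0) := by
    intro p hp
    induction p with
    | zero => exact fun k => Finset.subset_biUnion_of_mem (Os 0) (Finset.mem_univ k)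
    | succ p ih => exact (hstep p hp).subset_of_forall_subset_s7 (ih (by omega))
  have hbound : ∑ i : M, (Os t i).card ≤
      Fintype.card M * (Finset.univ.biUnion (Os 0)).card :=
    Finset.sum_le_card_nsmul _ _ _ fun k _ => Finset.card_le_card (hsub t le_rfl k)
  have ht := hsum t le_rfl
  exact ⟨ht, by omega⟩
end
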